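/- arXiv:2204.04032 — 2 statements merged into one kernel-verified Lean document; each statement's English description precedes it below -/
import Mathlib

section
/- Let v : ℝ → Matrix (Fin n) (Fin m) ℂ be smooth with v(x)ᴴ v(x) = 1 for all x, let A(x) = v(x)ᴴ v'(x), let P solve P'(x) = −A(x) P(x), P(x₀) = 1, and let Ω(b,a) = P(b) P(a)⁻¹. Define Ω²(b,a) = (1/2) ( v(b)ᴴ v(a) + ( v(a)ᴴ v(b) )⁻¹ ) and Ω³(x+h, x) = (4/3) Ω²(x+h, x+h/2) Ω²(x+h/2, x) − (1/3) Ω²(x+h, x). Then for every fixed x ∈ ℝ, as h → 0, Ω(x+h, x) − Ω³(x+h, x) = O(h⁴). -/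
open Matrix Filter Asymptotics

attribute [local instance] Matrix.normedAddCommGroup Matrix.normedSpace

/-- The order-2 approximation to parallel transport:
`Ω²(b,a) = ½ (v(b)ᴴ v(a) + (v(a)ᴴ v(b))⁻¹)`. -/
noncomputable def Omega2 {n m : ℕ} (v : ℝ → Matrix (Fin n) (Fin m) ℂ) (b a : ℝ) :
    Matrix (Fin m) (Fin m) ℂ :=
  (1 / 2 : ℂ) • ((v b)ᴴ * v a + ((v a)ᴴ * v b)⁻¹)

/-- The order-3 approximation to parallel transport:
`Ω³(x+h, x) = (4/3) Ω²(x+h, x+h/2) Ω²(x+h/2, x) - (1/3) Ω²(x+h, x)`. -/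
noncomputable def Omega3 {n m : ℕ} (v : ℝ → Matrix (Fin n) (Fin m) ℂ) (x h : ℝ) :
    Matrix (Fin m) (Fin m) ℂ :=
  (4 / 3 : ℂ) • (Omega2 v (x + h) (x + h / 2) * Omega2 v (x + h / 2) x)
    - (1 / 3 : ℂ) • Omega2 v (x + h) x

open scoped ContDiff

section MatrixCalculus

variable {l m n : ℕ}

/-- Matrix multiplication as a continuous real-bilinear map. -/
noncomputable def matrixMulCLM (l m n : ℕ) :
    Matrix (Fin l) (Fin m) ℂ →L[ℝ] Matrix (Fin m) (Fin n) ℂ →L[ℝ] Matrix (Fin l) (Fin n) ℂ :=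
  (LinearMap.mk₂ ℝ (fun A B => A * B) Matrix.add_mul (fun c A B => Matrix.smul_mul c A B)
    Matrix.mul_add (fun c A B => Matrix.mul_smul A c B)).toContinuousBilinearMap

/-- The conjugate transpose as a continuous real-linear map. -/
noncomputable def conjTransposeCLM (m n : ℕ) :
    Matrix (Fin m) (Fin n) ℂ →L[ℝ] Matrix (Fin n) (Fin m) ℂ :=
  LinearMap.toContinuousLinearMap
    { toFun := fun A => Aᴴ
      map_add' := Matrix.conjTranspose_add
      map_smul' := fun c A => by simp [Matrix.conjTranspose_smul] }

theorem HasDerivAt.matrix_mul {f : ℝ → Matrix (Fin l) (Fin m) ℂ}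
    {g : ℝ → Matrix (Fin m) (Fin n) ℂ} {f' : Matrix (Fin l) (Fin m) ℂ}
    {g' : Matrix (Fin m) (Fin n) ℂ} {t : ℝ} (hf : HasDerivAt f f' t) (hg : HasDerivAt g g' t) :
    HasDerivAt (fun t => f t * g t) (f' * g t + f t * g') t := by
  rw [add_comm]
  exact (matrixMulCLM l m n).hasDerivAt_of_bilinear (fun _ => hf) (fun _ => hg)

theorem HasDerivAt.matrix_conjTranspose {f : ℝ → Matrix (Fin m) (Fin n) ℂ}
    {f' : Matrix (Fin m) (Fin n) ℂ} {t : ℝ} (hf : HasDerivAt f f' t) :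
    HasDerivAt (fun t => (f t)ᴴ) f'ᴴ t :=
  (conjTransposeCLM m n).hasFDerivAt.comp_hasDerivAt t hf

theorem ContDiff.matrix_mul {k : ℕ∞ω} {f : ℝ → Matrix (Fin l) (Fin m) ℂ}
    {g : ℝ → Matrix (Fin m) (Fin n) ℂ} (hf : ContDiff ℝ k f) (hg : ContDiff ℝ k g) :
    ContDiff ℝ k fun t => f t * g t :=
  (matrixMulCLM l m n).isBoundedBilinearMap.contDiff.comp (hf.prodMk hg)

theorem ContDiff.matrix_conjTranspose {k : ℕ∞ω} {f : ℝ → Matrix (Fin m) (Fin n) ℂ}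
    (hf : ContDiff ℝ k f) : ContDiff ℝ k fun t => (f t)ᴴ :=
  (conjTransposeCLM m n).contDiff.comp hf

theorem Asymptotics.IsBigO.matrix_mul {α : Type*} {F : Filter α}
    {f : α → Matrix (Fin l) (Fin m) ℂ} {g : α → Matrix (Fin m) (Fin n) ℂ} {u v : α → ℝ}
    (hf : f =O[F] u) (hg : g =O[F] v) : (fun t => f t * g t) =O[F] fun t => u t * v t :=
  ((matrixMulCLM l m n).isBoundedBilinearMap.isBigO_comp (g := f) (h := g)).trans
    (hf.norm_left.mul hg.norm_left)

theorem Asymptotics.IsBigO.matrix_conjTranspose {α : Type*} {F : Filter α}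
    {f : α → Matrix (Fin m) (Fin n) ℂ} {u : α → ℝ} (hf : f =O[F] u) :
    (fun t => (f t)ᴴ) =O[F] u :=
  ((conjTransposeCLM m n).isBigO_comp f F).trans hf

/-- The Leibniz rule for `fᴴ g` when this product is constant. -/
theorem conjTranspose_deriv_mul_add_eq_zero {f : ℝ → Matrix (Fin l) (Fin m) ℂ}
    {g : ℝ → Matrix (Fin l) (Fin n) ℂ} {c : Matrix (Fin m) (Fin n) ℂ}
    (hf : Differentiable ℝ f) (hg : Differentiable ℝ g) (hc : ∀ t, (f t)ᴴ * g t = c) (t : ℝ) :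
    (deriv f t)ᴴ * g t + (f t)ᴴ * deriv g t = 0 := by
  have h := (hf t).hasDerivAt.matrix_conjTranspose.matrix_mul (hg t).hasDerivAt
  simp only [hc] at h
  exact h.unique (hasDerivAt_const t c)

end MatrixCalculus

/-- Third-order Taylor expansion of a `C⁴` function with `O(h⁴)` remainder. -/
theorem taylor_three_isBigO {E : Type*} [NormedAddCommGroup E] [NormedSpace ℝ E] {f : ℝ → E}
    (hf : ContDiff ℝ 4 f) (x : ℝ) :
    (fun h : ℝ => f (x + h) - (f x + h • deriv f x + (h ^ 2 / 2) • deriv (deriv f) x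
      + (h ^ 3 / 6) • deriv (deriv (deriv f)) x)) =O[nhds 0] fun h : ℝ => h ^ 4 := by
  have h1 := (taylor_isLittleO_univ (x₀ := x) (n := 4) hf).isBigO
  have h2 : Tendsto (fun h : ℝ => x + h) (nhds 0) (nhds x) := by
    simpa using (continuous_const.add continuous_id).tendsto (0 : ℝ) (f := fun h : ℝ => x + h)
  have h3 := h1.comp_tendsto h2
  have h4 : (fun h : ℝ => (h ^ 4 / 24) • iteratedDeriv 4 f x) =O[nhds 0] fun h : ℝ => h ^ 4 := by
    have h5 : (fun h : ℝ => h ^ 4 / 24) =O[nhds 0] fun h : ℝ => h ^ 4 := by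
      simpa only [div_eq_inv_mul] using (isBigO_refl (fun h : ℝ => h ^ 4) (nhds 0)).const_mul_left _
    simpa using h5.smul (isBigO_const_const (iteratedDeriv 4 f x) (one_ne_zero (α := ℝ)) _)
  refine ((h3.congr_right (g₂ := fun h : ℝ => h ^ 4) fun h => by simp).add h4).congr_left
    fun h => ?_
  simp only [Function.comp, taylor_within_apply, Finset.sum_range_succ, Finset.sum_range_zero,
    iteratedDerivWithin_univ, iteratedDeriv_succ, iteratedDeriv_zero, add_sub_cancel_left,
    Nat.factorial]
  push_cast
  module

/-- If `N = 1 + X + O(h⁴)` with `X = O(h²)`, then `N⁻¹ = 1 - X + O(h⁴)`. -/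
theorem inv_sub_one_sub_isBigO {m : ℕ} {N X : ℝ → Matrix (Fin m) (Fin m) ℂ}
    (hX : X =O[nhds 0] fun h : ℝ => h ^ 2)
    (hN : (fun h => N h - (1 + X h)) =O[nhds 0] fun h : ℝ => h ^ 4) :
    (fun h => (N h)⁻¹ - (1 - X h)) =O[nhds 0] fun h : ℝ => h ^ 4 := by
  have hX0 : Tendsto X (nhds 0) (nhds 0) := hX.trans_tendsto (by
    simpa using (continuous_pow 2).tendsto (0 : ℝ))
  have hN1 : Tendsto N (nhds 0) (nhds 1) := by
    have h1 : Tendsto (fun h => N h - (1 + X h)) (nhds 0) (nhds 0) := hN.trans_tendsto (by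
      simpa using (continuous_pow 4).tendsto (0 : ℝ))
    simpa using h1.add (hX0.const_add 1)
  have hdet : Tendsto (fun h => (N h).det) (nhds 0) (nhds 1) := by
    simpa [Function.comp_def] using ((continuous_id.matrix_det).tendsto (1 : Matrix (Fin m) (Fin m) ℂ)).comp hN1
  have hinv : (fun h => (N h)⁻¹) =O[nhds 0] fun _ => (1 : ℝ) := by
    have h1 : ContinuousAt Inv.inv (1 : Matrix (Fin m) (Fin m) ℂ) := by
      apply continuousAt_matrix_inv
      simp [Ring.inverse_eq_inv']
    exact (h1.tendsto.comp hN1).isBigO_one ℝ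
  have hone : (fun h => 1 - X h) =O[nhds 0] fun _ => (1 : ℝ) :=
    (hX0.const_sub 1).isBigO_one ℝ
  have hrem : (fun h => X h * X h - (N h - (1 + X h)) * (1 - X h)) =O[nhds 0]
      fun h : ℝ => h ^ 4 :=
    ((hX.matrix_mul hX).congr_right fun h => by ring).sub
      ((hN.matrix_mul hone).congr_right fun h => by ring)
  refine ((hinv.matrix_mul hrem).congr_right fun h => by ring).congr' ?_ .rfl
  filter_upwards [hdet.eventually_ne one_ne_zero] with h hh
  have hu : (N h)⁻¹ * N h = 1 := Matrix.nonsing_inv_mul _ (isUnit_iff_ne_zero.mpr hh)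
  have hr : X h * X h - (N h - (1 + X h)) * (1 - X h) = 1 - N h * (1 - X h) := by noncomm_ring
  rw [hr, mul_sub, ← mul_assoc, hu, mul_one, one_mul]

section Horizontal

variable {m n : ℕ} {w : ℝ → Matrix (Fin n) (Fin m) ℂ}

/-- The conditions on the Taylor coefficients of an isometric frame `w` with `wᴴ w' = 0`. -/
theorem horizontal_deriv_relations (hw : ContDiff ℝ 4 w)
    (hhor : ∀ t, (w t)ᴴ * deriv w t = 0) (t : ℝ) :
    (w t)ᴴ * deriv (deriv w) t = -((deriv w t)ᴴ * deriv w t) ∧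
    (w t)ᴴ * deriv (deriv (deriv w)) t =
      -((deriv (deriv w) t)ᴴ * deriv w t) - (2 : ℝ) • ((deriv w t)ᴴ * deriv (deriv w) t) := by
  have hw' : ContDiff ℝ 3 (deriv w) := hw.deriv' (n := 3)
  have hw'' : ContDiff ℝ 2 (deriv (deriv w)) := hw'.deriv' (n := 2)
  have d0 : Differentiable ℝ w := hw.differentiable (by norm_num)
  have d1 : Differentiable ℝ (deriv w) := hw'.differentiable (by norm_num)
  have d2 : Differentiable ℝ (deriv (deriv w)) := hw''.differentiable (by norm_num)
  have h1 := conjTranspose_deriv_mul_add_eq_zero d0 d1 hhor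
  refine ⟨eq_neg_of_add_eq_zero_right (h1 t), ?_⟩
  have h2 := ((d1 t).hasDerivAt.matrix_conjTranspose.matrix_mul (d1 t).hasDerivAt).add
    ((d0 t).hasDerivAt.matrix_conjTranspose.matrix_mul (d2 t).hasDerivAt)
  have h3 : (deriv (deriv w) t)ᴴ * deriv w t + (deriv w t)ᴴ * deriv (deriv w) t
      + ((deriv w t)ᴴ * deriv (deriv w) t + (w t)ᴴ * deriv (deriv (deriv w)) t) = 0 :=
    (h2.congr_of_eventuallyEq (.of_forall fun s => (h1 s).symm)).unique (hasDerivAt_const t 0)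
  refine sub_eq_zero.mp (Eq.trans ?_ h3)
  module

/-- Third-order expansion of the overlap matrices of a horizontal isometric frame. -/
theorem horizontal_overlap_isBigO (hw : ContDiff ℝ 4 w) (horth : ∀ t, (w t)ᴴ * w t = 1)
    (hhor : ∀ t, (w t)ᴴ * deriv w t = 0) (x α β : ℝ) :
    (fun h : ℝ => (w (x + α * h))ᴴ * w (x + β * h) - (1
      + (-((α - β) ^ 2 / 2 * h ^ 2) • ((deriv w x)ᴴ * deriv w x)
        + h ^ 3 • ((α * β ^ 2 / 2 - α ^ 3 / 6 - β ^ 3 / 3) • ((deriv w x)ᴴ * deriv (deriv w) x)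
          + (α ^ 2 * β / 2 - α ^ 3 / 3 - β ^ 3 / 6) • ((deriv (deriv w) x)ᴴ * deriv w x)))))
      =O[nhds 0] fun h : ℝ => h ^ 4 := by
  obtain ⟨h02, h03⟩ := horizontal_deriv_relations hw hhor x
  have h00 := horth x
  have h01 := hhor x
  have h10 := congrArg conjTranspose h01
  have h20 := congrArg conjTranspose h02
  have h30 := congrArg conjTranspose h03
  have hT := taylor_three_isBigO hw x
  have hc : Continuous w := hw.continuous
  set W1 := deriv w x
  set W2 := deriv (deriv w) x
  set W3 := deriv (deriv (deriv w)) x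
  simp only [conjTranspose_mul, conjTranspose_neg, conjTranspose_sub, conjTranspose_smul,
    conjTranspose_conjTranspose, conjTranspose_zero, star_trivial] at h10 h20 h30
  set T : ℝ → Matrix (Fin n) (Fin m) ℂ := fun h =>
    w x + h • W1 + (h ^ 2 / 2) • W2 + (h ^ 3 / 6) • W3 with hTdef
  have hTc : Continuous T := by fun_prop
  have hscale : ∀ γ : ℝ, (fun h => w (x + γ * h) - T (γ * h)) =O[nhds 0] fun h : ℝ => h ^ 4 := by
    intro γ
    have h1 : Tendsto (fun h : ℝ => γ * h) (nhds 0) (nhds 0) := by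
      simpa using (continuous_const_mul γ).tendsto 0
    refine (hT.comp_tendsto h1).trans ?_
    simpa only [Function.comp_def, mul_pow] using
      (isBigO_refl (fun h : ℝ => h ^ 4) (nhds 0)).const_mul_left (γ ^ 4)
  have hb1 : (fun h => w (x + β * h)) =O[nhds 0] fun _ => (1 : ℝ) :=
    (hc.comp (continuous_const.add (continuous_const_mul β))).continuousAt.tendsto.isBigO_one ℝ
  have hb2 : (fun h => (T (α * h))ᴴ) =O[nhds 0] fun _ => (1 : ℝ) :=
    (hTc.comp (continuous_const_mul α)).matrix_conjTranspose.continuousAt.tendsto.isBigO_one ℝ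
  have hprod := (((hscale α).matrix_conjTranspose.matrix_mul hb1).congr_right
    (g₂ := fun h : ℝ => h ^ 4) fun h => by ring).add
    ((hb2.matrix_mul (hscale β)).congr_right (g₂ := fun h : ℝ => h ^ 4) fun h => by ring)
  set R : ℝ → Matrix (Fin m) (Fin m) ℂ := fun h =>
    (α * β ^ 3 / 6) • (W1ᴴ * W3) + (α ^ 2 * β ^ 2 / 4) • (W2ᴴ * W2)
      + (α ^ 3 * β / 6) • (W3ᴴ * W1)
      + h • ((α ^ 2 * β ^ 3 / 12) • (W2ᴴ * W3) + (α ^ 3 * β ^ 2 / 12) • (W3ᴴ * W2))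
      + h ^ 2 • (α ^ 3 * β ^ 3 / 36) • (W3ᴴ * W3) with hR
  have hRc : Continuous R := by fun_prop
  have hrem : (fun h : ℝ => h ^ 4 • R h) =O[nhds 0] fun h : ℝ => h ^ 4 := by
    simpa using (isBigO_refl (fun h : ℝ => h ^ 4) (nhds 0)).smul
      (hRc.continuousAt.tendsto.isBigO_one ℝ)
  refine (hprod.add hrem).congr_left fun h => ?_
  have hexp : (T (α * h))ᴴ * T (β * h) = 1
      + (-((α - β) ^ 2 / 2 * h ^ 2) • (W1ᴴ * W1)
        + h ^ 3 • ((α * β ^ 2 / 2 - α ^ 3 / 6 - β ^ 3 / 3) • (W1ᴴ * W2)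
          + (α ^ 2 * β / 2 - α ^ 3 / 3 - β ^ 3 / 6) • (W2ᴴ * W1))) + h ^ 4 • R h := by
    simp only [hTdef, hR, conjTranspose_add, conjTranspose_smul, star_trivial, Matrix.add_mul,
      Matrix.mul_add, Matrix.smul_mul, Matrix.mul_smul, h00, h01, h02, h03, h10, h20, h30]
    module
  have hsplit : (w (x + α * h) - T (α * h))ᴴ * w (x + β * h)
      + (T (α * h))ᴴ * (w (x + β * h) - T (β * h))
      = (w (x + α * h))ᴴ * w (x + β * h) - (T (α * h))ᴴ * T (β * h) := by
    rw [conjTranspose_sub, Matrix.sub_mul, Matrix.mul_sub]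
    abel
  rw [hsplit, hexp]
  abel

/-- For a horizontal isometric frame, `Ω²` differs from the identity by a cubic term which is
homogeneous in the increment. -/
theorem horizontal_omega2_isBigO (hw : ContDiff ℝ 4 w) (horth : ∀ t, (w t)ᴴ * w t = 1)
    (hhor : ∀ t, (w t)ᴴ * deriv w t = 0) (x α β : ℝ) :
    (fun h : ℝ => Omega2 w (x + α * h) (x + β * h) - (1 + ((α - β) ^ 3 * h ^ 3) •
      ((1 / 12 : ℝ) • ((deriv w x)ᴴ * deriv (deriv w) x - (deriv (deriv w) x)ᴴ * deriv w x))))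
      =O[nhds 0] fun h : ℝ => h ^ 4 := by
  have hM := horizontal_overlap_isBigO hw horth hhor x α β
  have hN := horizontal_overlap_isBigO hw horth hhor x β α
  set G := (deriv w x)ᴴ * deriv w x
  set B := (deriv w x)ᴴ * deriv (deriv w) x
  set C := (deriv (deriv w) x)ᴴ * deriv w x
  have hX : (fun h : ℝ => -((β - α) ^ 2 / 2 * h ^ 2) • G
      + h ^ 3 • ((β * α ^ 2 / 2 - β ^ 3 / 6 - α ^ 3 / 3) • B
        + (β ^ 2 * α / 2 - β ^ 3 / 3 - α ^ 3 / 6) • C)) =O[nhds 0] fun h : ℝ => h ^ 2 := by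
    have hc : Continuous fun h : ℝ => -((β - α) ^ 2 / 2) • G
      + h • ((β * α ^ 2 / 2 - β ^ 3 / 6 - α ^ 3 / 3) • B
        + (β ^ 2 * α / 2 - β ^ 3 / 3 - α ^ 3 / 6) • C) := by fun_prop
    refine ((isBigO_refl (fun h : ℝ => h ^ 2) (nhds 0)).smul
      (hc.continuousAt.tendsto.isBigO_one ℝ)).congr (fun h => ?_) fun h => by simp
    module
  have hinv := inv_sub_one_sub_isBigO hX hN
  refine ((hM.add hinv).const_smul_left (1 / 2 : ℝ)).congr_left fun h => ?_
  have hcast : ∀ A : Matrix (Fin m) (Fin m) ℂ, (1 / 2 : ℂ) • A = (1 / 2 : ℝ) • A := fun A => by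
    rw [← Complex.coe_smul]; norm_num
  rw [Omega2, hcast, Pi.smul_apply]
  module

theorem horizontal_omega3_isBigO (hw : ContDiff ℝ 4 w) (horth : ∀ t, (w t)ᴴ * w t = 1)
    (hhor : ∀ t, (w t)ᴴ * deriv w t = 0) (x : ℝ) :
    (fun h : ℝ => 1 - Omega3 w x h) =O[nhds 0] fun h : ℝ => h ^ 4 := by
  have h1 := horizontal_omega2_isBigO hw horth hhor x 1 (1 / 2)
  have h2 := horizontal_omega2_isBigO hw horth hhor x (1 / 2) 0
  have h3 := horizontal_omega2_isBigO hw horth hhor x 1 0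
  set K := (1 / 12 : ℝ) •
    ((deriv w x)ᴴ * deriv (deriv w) x - (deriv (deriv w) x)ᴴ * deriv w x)
  have hc1 : ∀ a : ℝ, (fun h : ℝ => 1 + (a * h ^ 3) • K) =O[nhds 0] fun _ => (1 : ℝ) := fun a =>
    (show Continuous fun h : ℝ => 1 + (a * h ^ 3) • K by fun_prop).continuousAt.tendsto.isBigO_one ℝ
  have hone : (fun h : ℝ => h ^ 4) =O[nhds 0] fun _ => (1 : ℝ) :=
    (continuous_pow 4).continuousAt.tendsto.isBigO_one ℝ
  have hb : (fun h : ℝ => Omega2 w (x + 1 / 2 * h) (x + 0 * h)) =O[nhds 0] fun _ => (1 : ℝ) :=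
    ((h2.trans hone).add (hc1 _)).congr_left fun h => sub_add_cancel _ _
  have hK : (fun h : ℝ => h ^ 4 • (h ^ 2 • (1 / 64 : ℝ) • (K * K))) =O[nhds 0]
      fun h : ℝ => h ^ 4 := by
    have hc : Continuous fun h : ℝ => h ^ 2 • (1 / 64 : ℝ) • (K * K) := by fun_prop
    simpa using (isBigO_refl (fun h : ℝ => h ^ 4) (nhds 0)).smul
      (hc.continuousAt.tendsto.isBigO_one ℝ)
  have hprod := (((h1.matrix_mul hb).congr_right (g₂ := fun h : ℝ => h ^ 4) fun h => by ring).add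
    (((hc1 ((1 - 1 / 2) ^ 3)).matrix_mul h2).congr_right (g₂ := fun h : ℝ => h ^ 4) fun h => by ring)).add hK
  refine ((hprod.const_smul_left (-4 / 3 : ℝ)).add (h3.const_smul_left (1 / 3 : ℝ))).congr_left
    fun h => ?_
  have hcast : ∀ (r : ℝ) (A : Matrix (Fin m) (Fin m) ℂ), (r : ℂ) • A = r • A :=
    fun r A => Complex.coe_smul r A
  have e1 : x + 1 * h = x + h := by ring
  have e2 : x + 1 / 2 * h = x + h / 2 := by ring
  have e3 : x + 0 * h = x := by ring
  have h43 : (4 / 3 : ℂ) = ((4 / 3 : ℝ) : ℂ) := by norm_num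
  have h13 : (1 / 3 : ℂ) = ((1 / 3 : ℝ) : ℂ) := by norm_num
  rw [Omega3, h43, h13, hcast, hcast]
  simp only [Pi.smul_apply, e1, e2, e3, Matrix.sub_mul, Matrix.mul_sub, Matrix.add_mul, Matrix.mul_add, Matrix.one_mul,
    Matrix.mul_one, Matrix.smul_mul, Matrix.mul_smul]
  module

end Horizontal

/-- A gauge transformation by a unitary `P` conjugates `Ω²`. -/
theorem omega2_gauge {m n : ℕ} {v : ℝ → Matrix (Fin n) (Fin m) ℂ}
    {P : ℝ → Matrix (Fin m) (Fin m) ℂ} (hP : ∀ t, (P t)ᴴ * P t = 1) (b a : ℝ) :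
    Omega2 v b a = P b * Omega2 (fun t => v t * P t) b a * (P a)ᴴ := by
  have hP' : ∀ t, P t * (P t)ᴴ = 1 := fun t => mul_eq_one_comm.mp (hP t)
  have hinv : ∀ t, (P t)⁻¹ = (P t)ᴴ := fun t => Matrix.inv_eq_left_inv (hP t)
  have hinv' : ∀ t, (P t)ᴴ⁻¹ = P t := fun t => Matrix.inv_eq_left_inv (hP' t)
  have h1 : (v b)ᴴ * v a = P b * ((v b * P b)ᴴ * (v a * P a)) * (P a)ᴴ := by
    rw [conjTranspose_mul]
    calc (v b)ᴴ * v a = (P b * (P b)ᴴ) * ((v b)ᴴ * v a) * (P a * (P a)ᴴ) := by simp [hP']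
      _ = _ := by simp only [Matrix.mul_assoc]
  have h2 : ((v a)ᴴ * v b)⁻¹ = P b * ((v a * P a)ᴴ * (v b * P b))⁻¹ * (P a)ᴴ := by
    have h3 : (v a * P a)ᴴ * (v b * P b) = (P a)ᴴ * ((v a)ᴴ * v b) * P b := by
      simp only [conjTranspose_mul, Matrix.mul_assoc]
    rw [h3, Matrix.mul_inv_rev, Matrix.mul_inv_rev, hinv, hinv']
    calc ((v a)ᴴ * v b)⁻¹ = (P b * (P b)ᴴ) * ((v a)ᴴ * v b)⁻¹ * (P a * (P a)ᴴ) := by simp [hP']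
      _ = _ := by simp only [Matrix.mul_assoc]
  simp only [Omega2]
  rw [Matrix.mul_smul, Matrix.smul_mul, Matrix.mul_add, Matrix.add_mul, ← h1, ← h2]

theorem omega3_gauge {m n : ℕ} {v : ℝ → Matrix (Fin n) (Fin m) ℂ}
    {P : ℝ → Matrix (Fin m) (Fin m) ℂ} (hP : ∀ t, (P t)ᴴ * P t = 1) (x h : ℝ) :
    Omega3 v x h = P (x + h) * Omega3 (fun t => v t * P t) x h * (P x)ᴴ := by
  have hcancel : ∀ A B : Matrix (Fin m) (Fin m) ℂ,
      P (x + h) * A * (P (x + h / 2))ᴴ * (P (x + h / 2) * B * (P x)ᴴ)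
        = P (x + h) * (A * B) * (P x)ᴴ := fun A B => by
    calc _ = P (x + h) * A * ((P (x + h / 2))ᴴ * P (x + h / 2)) * (B * (P x)ᴴ) := by
          simp only [Matrix.mul_assoc]
      _ = _ := by simp only [hP, Matrix.mul_one, Matrix.mul_assoc]
  simp only [Omega3]
  rw [omega2_gauge hP (x + h) (x + h / 2), omega2_gauge hP (x + h / 2) x,
    omega2_gauge hP (x + h) x, hcancel]
  simp only [Matrix.mul_sub, Matrix.sub_mul, Matrix.mul_smul, Matrix.smul_mul]

/-- Solutions of a linear matrix equation with smooth coefficients are smooth. -/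
theorem contDiff_of_linear_ode {m : ℕ} {A P : ℝ → Matrix (Fin m) (Fin m) ℂ}
    (hA : ContDiff ℝ ∞ A) (hP : ∀ t, HasDerivAt P (A t * P t) t) (k : ℕ) :
    ContDiff ℝ k P := by
  have hd : Differentiable ℝ P := fun t => (hP t).differentiableAt
  induction k with
  | zero => exact contDiff_zero.mpr hd.continuous
  | succ k ih =>
    have he : deriv P = fun t => A t * P t := funext fun t => (hP t).deriv
    rw [Nat.cast_succ, contDiff_succ_iff_deriv]
    refine ⟨hd, fun h => absurd h (by simp), he ▸ (contDiff_infty.mp hA k).matrix_mul ih⟩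

/-- The order-3 approximation to parallel transport of the induced connection: if `v` is smooth
with `vᴴ v = 1`, `A = vᴴ v'`, `P' = -A P`, `P x₀ = 1` and `Ω(b,a) = P(b) P(a)⁻¹`, then
`Ω(x+h, x) - Ω³(x+h, x) = O(h⁴)` as `h → 0`. -/
theorem order_three_approximation {n m : ℕ}
    (v : ℝ → Matrix (Fin n) (Fin m) ℂ)
    (hv : ContDiff ℝ (⊤ : ℕ∞) v)
    (horth : ∀ x : ℝ, (v x)ᴴ * v x = 1)
    (P : ℝ → Matrix (Fin m) (Fin m) ℂ)
    (x₀ : ℝ)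
    (hP : ∀ x : ℝ, HasDerivAt P (-((v x)ᴴ * deriv v x) * P x) x)
    (hP₀ : P x₀ = 1)
    (Ω : ℝ → ℝ → Matrix (Fin m) (Fin m) ℂ)
    (hΩ : ∀ b a : ℝ, Ω b a = P b * (P a)⁻¹)
    (x : ℝ) :
    (fun h : ℝ => Ω (x + h) x - Omega3 v x h) =O[nhds 0] fun h : ℝ => h ^ 4 := by
  have hsmooth : ContDiff ℝ ∞ v := hv
  have dv : Differentiable ℝ v := hv.differentiable (by simp)
  have hv' : ContDiff ℝ ∞ (deriv v) := (contDiff_infty_iff_deriv.mp hsmooth).2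
  have hA : ContDiff ℝ ∞ fun t => -((v t)ᴴ * deriv v t) :=
    (hsmooth.matrix_conjTranspose.matrix_mul hv').neg
  have hP4 : ContDiff ℝ 4 P := contDiff_of_linear_ode hA hP 4
  have hanti : ∀ t, (deriv v t)ᴴ * v t + (v t)ᴴ * deriv v t = 0 :=
    conjTranspose_deriv_mul_add_eq_zero dv dv horth
  have hunit : ∀ t, (P t)ᴴ * P t = 1 := by
    have hder : ∀ t, HasDerivAt (fun s => (P s)ᴴ * P s) 0 t := fun t => by
      convert (hP t).matrix_conjTranspose.matrix_mul (hP t) using 1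
      have h1 : (-((v t)ᴴ * deriv v t) * P t)ᴴ * P t + (P t)ᴴ * (-((v t)ᴴ * deriv v t) * P t)
          = -((P t)ᴴ * ((deriv v t)ᴴ * v t + (v t)ᴴ * deriv v t) * P t) := by
        simp only [conjTranspose_mul, conjTranspose_neg, conjTranspose_conjTranspose,
          Matrix.mul_add, Matrix.add_mul, Matrix.neg_mul, Matrix.mul_neg, Matrix.mul_assoc]
        abel
      rw [h1, hanti]
      simp
    intro t
    have h2 := is_const_of_deriv_eq_zero (fun s => (hder s).differentiableAt)
      (fun s => (hder s).deriv) t x₀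
    simpa [hP₀] using h2
  have hw : ContDiff ℝ 4 fun t => v t * P t :=
    (contDiff_infty.mp hsmooth 4).matrix_mul hP4
  have hworth : ∀ t, (v t * P t)ᴴ * (v t * P t) = 1 := fun t => by
    rw [conjTranspose_mul, Matrix.mul_assoc, ← Matrix.mul_assoc _ _ (P t), horth, Matrix.one_mul,
      hunit]
  have hwhor : ∀ t, (v t * P t)ᴴ * deriv (fun s => v s * P s) t = 0 := fun t => by
    have hd : deriv (fun s => v s * P s) t =
        deriv v t * P t + v t * (-((v t)ᴴ * deriv v t) * P t) :=
      ((dv t).hasDerivAt.matrix_mul (hP t)).deriv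
    rw [hd, conjTranspose_mul, Matrix.mul_assoc,
      Matrix.mul_add, ← Matrix.mul_assoc _ (v t), horth]
    simp [Matrix.mul_assoc]
  have hmain := horizontal_omega3_isBigO hw hworth hwhor x
  have hPb : (fun h : ℝ => P (x + h)) =O[nhds 0] fun _ => (1 : ℝ) :=
    (hP4.continuous.comp (continuous_const.add continuous_id)).continuousAt.tendsto.isBigO_one ℝ
  have hPx : (fun _ : ℝ => (P x)ᴴ) =O[nhds 0] fun _ => (1 : ℝ) :=
    isBigO_const_const _ one_ne_zero _
  refine ((hPb.matrix_mul hmain).matrix_mul hPx).congr (fun h => ?_) fun h => by ring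
  rw [hΩ, Matrix.inv_eq_left_inv (hunit x), omega3_gauge (v := v) hunit, Matrix.mul_sub, Matrix.sub_mul,
    Matrix.mul_one]
end

section
/- Let v : ℝ → Matrix (Fin n) (Fin m) ℂ be smooth with v(x)ᴴ v(x) = 1 for all x, let A(x) = v(x)ᴴ v'(x), let P solve P'(x) = −A(x) P(x), P(x₀) = 1, let Ω(b,a) = P(b) P(a)⁻¹, and let z : ℝ → (Fin n → ℂ) be smooth. Define F : ℝ × ℝ → (Fin n → ℂ) by F(h, x) = v(x) · Ω(x, x−h) · v(x−h)ᴴ · z(x−h). Then F is differentiable and satisfies the first-order partial differential equation (∂F/∂x)(h,x) + (∂F/∂h)(h,x) = ( v'(x) v(x)ᴴ − v(x) A(x) v(x)ᴴ ) · F(h, x) for all (h, x) ∈ ℝ × ℝ. -/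
open Matrix Filter Asymptotics

attribute [local instance] Matrix.normedAddCommGroup Matrix.normedSpace

theorem HasDerivAt.matrix_entry {l k : ℕ} {M : ℝ → Matrix (Fin l) (Fin k) ℂ}
    {M' : Matrix (Fin l) (Fin k) ℂ} {x : ℝ} (hM : HasDerivAt M M' x) (i : Fin l) (j : Fin k) :
    HasDerivAt (fun y => M y i j) (M' i j) x :=
  hasDerivAt_pi.1 (hasDerivAt_pi.1 hM i) j

theorem hasDerivAt_matrix_of_entry {l k : ℕ} {M : ℝ → Matrix (Fin l) (Fin k) ℂ}
    {M' : Matrix (Fin l) (Fin k) ℂ} {x : ℝ}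
    (hM : ∀ i j, HasDerivAt (fun y => M y i j) (M' i j) x) : HasDerivAt M M' x :=
  hasDerivAt_pi.2 fun i => hasDerivAt_pi.2 (hM i)

theorem HasDerivAt.matrix_mul_s12 {l k p : ℕ} {M : ℝ → Matrix (Fin l) (Fin k) ℂ}
    {N : ℝ → Matrix (Fin k) (Fin p) ℂ} {M' : Matrix (Fin l) (Fin k) ℂ}
    {N' : Matrix (Fin k) (Fin p) ℂ} {x : ℝ} (hM : HasDerivAt M M' x) (hN : HasDerivAt N N' x) :
    HasDerivAt (fun y => M y * N y) (M' * N x + M x * N') x := by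
  refine hasDerivAt_matrix_of_entry fun i j => ?_
  simp only [Matrix.mul_apply, Matrix.add_apply, ← Finset.sum_add_distrib]
  exact HasDerivAt.fun_sum fun a _ => (hM.matrix_entry i a).mul (hN.matrix_entry a j)

theorem HasDerivAt.matrix_mulVec {l k : ℕ} {M : ℝ → Matrix (Fin l) (Fin k) ℂ}
    {w : ℝ → Fin k → ℂ} {M' : Matrix (Fin l) (Fin k) ℂ} {w' : Fin k → ℂ} {x : ℝ}
    (hM : HasDerivAt M M' x) (hw : HasDerivAt w w' x) :
    HasDerivAt (fun y => M y *ᵥ w y) (M' *ᵥ w x + M x *ᵥ w') x := by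
  refine hasDerivAt_pi.2 fun i => ?_
  simp only [Matrix.mulVec, dotProduct, Pi.add_apply, ← Finset.sum_add_distrib]
  exact HasDerivAt.fun_sum fun a _ => (hM.matrix_entry i a).mul (hasDerivAt_pi.1 hw a)

theorem HasDerivAt.matrix_conjTranspose_s12 {l k : ℕ} {M : ℝ → Matrix (Fin l) (Fin k) ℂ}
    {M' : Matrix (Fin l) (Fin k) ℂ} {x : ℝ} (hM : HasDerivAt M M' x) :
    HasDerivAt (fun y => (M y)ᴴ) M'ᴴ x :=
  hasDerivAt_matrix_of_entry fun i j => (hM.matrix_entry j i).star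

/-- The connection matrix of an orthonormal frame is anti-hermitian. -/
theorem conjTranspose_deriv_mul_add_eq_zero_s12 {n m : ℕ} {v : ℝ → Matrix (Fin n) (Fin m) ℂ}
    {x : ℝ} (hv : DifferentiableAt ℝ v x) (horth : ∀ x : ℝ, (v x)ᴴ * v x = 1) :
    (deriv v x)ᴴ * v x + (v x)ᴴ * deriv v x = 0 := by
  refine (hv.hasDerivAt.matrix_conjTranspose_s12.matrix_mul_s12 hv.hasDerivAt).unique ?_
  simpa only [horth] using hasDerivAt_const x (1 : Matrix (Fin m) (Fin m) ℂ)

/-- A solution of `P' = -A P`, `P x₀ = 1` with `A` anti-hermitian is unitary. -/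
theorem conjTranspose_mul_self_eq_one_of_hasDerivAt {m : ℕ}
    {A P : ℝ → Matrix (Fin m) (Fin m) ℂ} {x₀ : ℝ} (hA : ∀ x, (A x)ᴴ + A x = 0)
    (hP : ∀ x, HasDerivAt P (-(A x) * P x) x) (hP₀ : P x₀ = 1) (x : ℝ) :
    (P x)ᴴ * P x = 1 := by
  have hd (y : ℝ) : HasDerivAt (fun t => (P t)ᴴ * P t) 0 y := by
    convert (hP y).matrix_conjTranspose_s12.matrix_mul_s12 (hP y) using 1
    rw [conjTranspose_mul, conjTranspose_neg, eq_neg_of_add_eq_zero_left (hA y)]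
    simp [Matrix.mul_assoc]
  have hc := is_const_of_deriv_eq_zero (fun y => (hd y).differentiableAt)
    (fun y => (hd y).deriv) x x₀
  simpa [hP₀] using hc

/-- Let `v` be a smooth orthonormal frame, `A = vᴴ v'` the induced connection matrix,
`P' = -A P`, `P x₀ = 1`, `Ω(b,a) = P(b) P(a)⁻¹` the parallel transport operator, and `z` a
smooth vector-valued function.  Then `F(h, x) = v(x) Ω(x, x-h) v(x-h)ᴴ z(x-h)` is
differentiable and satisfies
`∂F/∂x + ∂F/∂h = (v' vᴴ - v A vᴴ) F`. -/
theorem omega_operator_pde {n m : ℕ}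
    (v : ℝ → Matrix (Fin n) (Fin m) ℂ)
    (hv : ContDiff ℝ (⊤ : ℕ∞) v)
    (horth : ∀ x : ℝ, (v x)ᴴ * v x = 1)
    (P : ℝ → Matrix (Fin m) (Fin m) ℂ)
    (x₀ : ℝ)
    (hP : ∀ x : ℝ, HasDerivAt P (-((v x)ᴴ * deriv v x) * P x) x)
    (hP₀ : P x₀ = 1)
    (Ω : ℝ → ℝ → Matrix (Fin m) (Fin m) ℂ)
    (hΩ : ∀ b a : ℝ, Ω b a = P b * (P a)⁻¹)
    (z : ℝ → Fin n → ℂ)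
    (hz : ContDiff ℝ (⊤ : ℕ∞) z)
    (F : ℝ × ℝ → Fin n → ℂ)
    (hF : ∀ h x : ℝ, F (h, x) = v x *ᵥ (Ω x (x - h) *ᵥ ((v (x - h))ᴴ *ᵥ z (x - h)))) :
    Differentiable ℝ F ∧
      ∀ h x : ℝ,
        deriv (fun x' : ℝ => F (h, x')) x + deriv (fun h' : ℝ => F (h', x)) h =
          (deriv v x * (v x)ᴴ - v x * ((v x)ᴴ * deriv v x) * (v x)ᴴ) *ᵥ F (h, x) := by
  have hvd (x : ℝ) : HasDerivAt v (deriv v x) x :=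
    (hv.differentiable (by simp) x).hasDerivAt
  have hzd (x : ℝ) : HasDerivAt z (deriv z x) x :=
    (hz.differentiable (by simp) x).hasDerivAt
  have hPinv (x : ℝ) : (P x)⁻¹ = (P x)ᴴ := by
    refine inv_eq_left_inv (conjTranspose_mul_self_eq_one_of_hasDerivAt
      (A := fun x => (v x)ᴴ * deriv v x) (fun y => ?_) hP hP₀ x)
    simpa using conjTranspose_deriv_mul_add_eq_zero_s12 (hvd y).differentiableAt horth
  set g : ℝ → Fin m → ℂ := fun y => (P y)ᴴ *ᵥ ((v y)ᴴ *ᵥ z y)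
  have hF' (h x : ℝ) : F (h, x) = (v x * P x) *ᵥ g (x - h) := by
    simp [hF, hΩ, hPinv, g, Matrix.mul_assoc]
  have hg (y : ℝ) : HasDerivAt g (deriv g y) y :=
    ((hP y).matrix_conjTranspose_s12.matrix_mulVec
      ((hvd y).matrix_conjTranspose_s12.matrix_mulVec (hzd y))).differentiableAt.hasDerivAt
  have hQ (x : ℝ) := (hvd x).matrix_mul_s12 (hP x)
  constructor
  · have hF_eq : F = fun p => (v p.2 * P p.2) *ᵥ g (p.2 - p.1) := funext fun p => hF' p.1 p.2
    rw [hF_eq]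
    refine differentiable_pi.2 fun i => ?_
    simp only [Matrix.mulVec, dotProduct]
    refine Differentiable.fun_sum fun a _ => Differentiable.mul ?_ ?_
    · have hQd : Differentiable ℝ fun x => (v x * P x) i a :=
        fun x => ((hQ x).matrix_entry i a).differentiableAt
      exact hQd.comp differentiable_snd
    · have hgd : Differentiable ℝ fun y => g y a :=
        fun y => (hasDerivAt_pi.1 (hg y) a).differentiableAt
      exact hgd.comp (differentiable_snd.sub differentiable_fst)
  · intro h x
    have hx := (hQ x).matrix_mulVec ((hg (x - h)).comp_sub_const x h)
    have hh := (hasDerivAt_const h (v x * P x)).matrix_mulVec ((hg (x - h)).comp_const_sub x h)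
    simp only [hF']
    rw [hx.deriv, hh.deriv]
    have hcancel : (v x)ᴴ * (v x * P x) = P x := by
      rw [← Matrix.mul_assoc, horth, Matrix.one_mul]
    have hcoef : (deriv v x * (v x)ᴴ - v x * ((v x)ᴴ * deriv v x) * (v x)ᴴ) * (v x * P x) =
        deriv v x * P x + v x * (-((v x)ᴴ * deriv v x) * P x) := by
      rw [Matrix.sub_mul, Matrix.mul_assoc _ _ (v x * P x), Matrix.mul_assoc _ _ (v x * P x),
        hcancel, Matrix.neg_mul, Matrix.mul_neg, ← sub_eq_add_neg, Matrix.mul_assoc (v x)]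
    rw [mulVec_mulVec (g (x - h)), hcoef]
    simp [mulVec_neg]
end
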